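/- Equivalence of the old and new operational semantics (the paper's Theorem 1, with Lolli provability of G from !P rendered by the uniform-provability semantics of the fragment): for every program P (a set of D-formulas) and every goal G (a G-formula), executing G from P terminates with success under the new semantics `prove` if and only if G is solvable from P under the old semantics `prov`. -/

import Mathlib

/-- Goals (G-formulas) of Prolog^{⊕,&}:
`G ::= A | G ⊗ G | ∃x G | G & G | G ⊕ G`.
Quantification is rendered in higher-order abstract syntax over an abstract
type `Term` of first-order terms, so that `[t/x]G` is function application. -/
inductive Goal (Atom : Type) (Term : Type) : Type
  | atom   : Atom → Goal Atom Term                          -- A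
  | tensor : Goal Atom Term → Goal Atom Term → Goal Atom Term -- G₁ ⊗ G₂
  | ex     : (Term → Goal Atom Term) → Goal Atom Term         -- ∃x G
  | wth    : Goal Atom Term → Goal Atom Term → Goal Atom Term -- G₁ & G₂
  | plus   : Goal Atom Term → Goal Atom Term → Goal Atom Term -- G₁ ⊕ G₂

/-- Clauses (D-formulas): `D ::= A | G ⊃ A | ∀x D`. -/
inductive Clause (Atom : Type) (Term : Type) : Type
  | atom : Atom → Clause Atom Term                            -- A
  | imp  : Goal Atom Term → Atom → Clause Atom Term           -- G ⊃ A
  | all  : (Term → Clause Atom Term) → Clause Atom Term       -- ∀x D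

/- The old uniform-provability semantics `prov`, as a pair of mutually
inductive judgments: `Prov P G` (goal-reduction phase) and
`ProvBC P D A` (backchaining phase with distinguished clause `D`,
i.e. `prov(D;P, A)` where `D;P = {D} ∪ P` with `D` distinguished). -/
mutual
inductive Prov {Atom Term : Type} : Set (Clause Atom Term) → Goal Atom Term → Prop
  | atom {P D A} : D ∈ P → ProvBC P D A → Prov P (Goal.atom A)
  | tensor {P G₁ G₂} : Prov P G₁ → Prov P G₂ → Prov P (Goal.tensor G₁ G₂)
  | wth {P G₁ G₂} : Prov P G₁ → Prov P G₂ → Prov P (Goal.wth G₁ G₂)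
  | plusL {P G₁ G₂} : Prov P G₁ → Prov P (Goal.plus G₁ G₂)
  | plusR {P G₁ G₂} : Prov P G₂ → Prov P (Goal.plus G₁ G₂)
  | ex {P} {G : Term → Goal Atom Term} (t : Term) : Prov P (G t) → Prov P (Goal.ex G)

inductive ProvBC {Atom Term : Type} : Set (Clause Atom Term) → Clause Atom Term → Atom → Prop
  | atom {P A} : ProvBC P (Clause.atom A) A
  | imp {P G₁ A} : Prov P G₁ → ProvBC P (Clause.imp G₁ A) A
  | all {P} {D : Term → Clause Atom Term} {A} (t : Term) :
      ProvBC P (D t) A → ProvBC P (Clause.all D) A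
end

/- The new interactive semantics `prove`: same as `prov` except for the
`&`-rule, which lets the user choose `i ∈ {0,1}`, solves the chosen conjunct
`G_i` with `prove`, and the unchosen conjunct `G_{(i+1) mod 2}` with `prov`. -/
mutual
inductive Prove {Atom Term : Type} : Set (Clause Atom Term) → Goal Atom Term → Prop
  | atom {P D A} : D ∈ P → ProveBC P D A → Prove P (Goal.atom A)
  | tensor {P G₁ G₂} : Prove P G₁ → Prove P G₂ → Prove P (Goal.tensor G₁ G₂)
  | wthL {P G₀ G₁} : Prove P G₀ → Prov P G₁ → Prove P (Goal.wth G₀ G₁)  -- user chose i = 0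
  | wthR {P G₀ G₁} : Prove P G₁ → Prov P G₀ → Prove P (Goal.wth G₀ G₁)  -- user chose i = 1
  | plusL {P G₁ G₂} : Prove P G₁ → Prove P (Goal.plus G₁ G₂)
  | plusR {P G₁ G₂} : Prove P G₂ → Prove P (Goal.plus G₁ G₂)
  | ex {P} {G : Term → Goal Atom Term} (t : Term) : Prove P (G t) → Prove P (Goal.ex G)

inductive ProveBC {Atom Term : Type} : Set (Clause Atom Term) → Clause Atom Term → Atom → Prop
  | atom {P A} : ProveBC P (Clause.atom A) A
  | imp {P G₁ A} : Prove P G₁ → ProveBC P (Clause.imp G₁ A) A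
  | all {P} {D : Term → Clause Atom Term} {A} (t : Term) :
      ProveBC P (D t) A → ProveBC P (Clause.all D) A
end

mutual
theorem Prove.prov {Atom Term : Type} {P : Set (Clause Atom Term)} {G : Goal Atom Term} :
    Prove P G → Prov P G
  | .atom hD h => .atom hD h.provBC
  | .tensor h₁ h₂ => .tensor h₁.prov h₂.prov
  | .wthL h₀ h₁ => .wth h₀.prov h₁
  | .wthR h₁ h₀ => .wth h₀ h₁.prov
  | .plusL h => .plusL h.prov
  | .plusR h => .plusR h.prov
  | .ex t h => .ex t h.prov

theorem ProveBC.provBC {Atom Term : Type} {P : Set (Clause Atom Term)} {D : Clause Atom Term}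
    {A : Atom} : ProveBC P D A → ProvBC P D A
  | .atom => .atom
  | .imp h => .imp h.prov
  | .all t h => .all t h.provBC
end

mutual
theorem Prov.prove {Atom Term : Type} {P : Set (Clause Atom Term)} {G : Goal Atom Term} :
    Prov P G → Prove P G
  | .atom hD h => .atom hD h.proveBC
  | .tensor h₁ h₂ => .tensor h₁.prove h₂.prove
  | .wth h₁ h₂ => .wthL h₁.prove h₂
  | .plusL h => .plusL h.prove
  | .plusR h => .plusR h.prove
  | .ex t h => .ex t h.prove

theorem ProvBC.proveBC {Atom Term : Type} {P : Set (Clause Atom Term)} {D : Clause Atom Term}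
    {A : Atom} : ProvBC P D A → ProveBC P D A
  | .atom => .atom
  | .imp h => .imp h.prove
  | .all t h => .all t h.proveBC
end

/-- **Equivalence** of the old and new operational semantics (the paper's
Theorem 1, with Lolli provability of `G` from `!P` rendered by the
uniform-provability semantics `prov` of the fragment): for every program `P`
and every goal `G`, executing `G` from `P` terminates with success under the
new semantics `prove` if and only if `G` is solvable from `P` under the old
semantics `prov`. -/
theorem prove_iff_prov {Atom Term : Type}
    (P : Set (Clause Atom Term)) (G : Goal Atom Term) :
    Prove P G ↔ Prov P G := by
  exact ⟨Prove.prov, Prov.prove⟩
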